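/- arXiv:1809.02689 — 6 statements merged into one kernel-verified Lean document; each statement's English description precedes it below -/
import Mathlib

section
/- Let F be a totally real number field with F ≠ ℚ, regarded as a subfield of ℝ via a distinguished real embedding (the identity embedding), and let N > 0 be a real number. Then there are infinitely many units u of the ring of integers O_F such that u > N (at the identity embedding) and 0 < σ(u) < 1 for every real embedding σ of F other than the identity embedding. -/
open NumberField

namespace NumberField

variable {F : Type*} [Field F]

/-- The infinite place of a real embedding `σ` is `x ↦ |σ x|`. -/
theorem InfinitePlace.mk_ofRealHom_comp_apply (σ : F →+* ℝ) (x : F) :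
    InfinitePlace.mk (Complex.ofRealHom.comp σ) x = |σ x| := by
  rw [InfinitePlace.apply]
  simp

/-- Distinct real embeddings define distinct infinite places. -/
theorem InfinitePlace.mk_ofRealHom_comp_injective :
    Function.Injective fun σ : F →+* ℝ ↦ InfinitePlace.mk (Complex.ofRealHom.comp σ) := by
  intro σ τ h
  have key : Complex.ofRealHom.comp σ = Complex.ofRealHom.comp τ := by
    rcases InfinitePlace.mk_eq_iff.mp h with h | h
    · exact h
    · rw [← h]
      ext x
      simp [ComplexEmbedding.conjugate_coe_eq]
  ext x
  simpa using RingHom.congr_fun key x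

theorem InfinitePlace.nontrivial_of_isTotallyReal [NumberField F] [IsTotallyReal F]
    (hF : 1 < Module.finrank ℚ F) : Nontrivial (InfinitePlace F) := by
  rw [← Fintype.one_lt_card_iff_nontrivial]
  rwa [IsTotallyReal.finrank, ← add_zero (nrRealPlaces F),
    ← IsTotallyReal.nrComplexPlaces_eq_zero F, ← card_eq_nrRealPlaces_add_nrComplexPlaces] at hF

/-- A unit that is less than one at all infinite places but `w₁` is greater than one at `w₁`. -/
theorem Units.one_lt_of_forall_ne_lt_one [NumberField F] [Nontrivial (InfinitePlace F)]
    {w₁ : InfinitePlace F} {u : (𝓞 F)ˣ} (hu : ∀ w, w ≠ w₁ → w (u : F) < 1) : 1 < w₁ (u : F) := by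
  obtain ⟨w, hw⟩ := exists_ne w₁
  by_contra! h
  have hprod : ∏ w : InfinitePlace F, w (u : F) ^ w.mult = 1 := by
    rw [InfinitePlace.prod_eq_abs_norm, Units.norm, Rat.cast_one]
  refine hprod.not_lt ?_
  calc
    _ < ∏ _w : InfinitePlace F, (1 : ℝ) := by
      refine Finset.prod_lt_prod (fun w _ ↦ pow_pos (pos_at_place u w) _) (fun v _ ↦ ?_)
        ⟨w, Finset.mem_univ _,
          pow_lt_one₀ (pos_at_place u w).le (hu w hw) InfinitePlace.mult_ne_zero⟩
      refine pow_le_one₀ (pos_at_place u v).le ?_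
      by_cases hv : v = w₁
      · exact hv ▸ h
      · exact (hu v hv).le
    _ = 1 := by simp

end NumberField

open Filter InfinitePlace in
/-- For a totally real number field `F ≠ ℚ` (regarded as a subfield of `ℝ`
via a distinguished embedding `ι`) and any `N > 0`, there are infinitely many units `u` of the
ring of integers `𝓞 F` with `ι u > N` and `0 < σ u < 1` for every real embedding `σ ≠ ι`. -/
theorem exists_infinitely_many_special_units
    (F : Type*) [Field F] [NumberField F]
    (htotallyReal : ∀ φ : F →+* ℂ, ∀ x : F, (φ x).im = 0)
    (hF : 1 < Module.finrank ℚ F)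
    (ι : F →+* ℝ) (N : ℝ) (hN : 0 < N) :
    {u : (𝓞 F)ˣ |
      N < ι (algebraMap (𝓞 F) F (u : 𝓞 F)) ∧
      ∀ σ : F →+* ℝ, σ ≠ ι →
        0 < σ (algebraMap (𝓞 F) F (u : 𝓞 F)) ∧
        σ (algebraMap (𝓞 F) F (u : 𝓞 F)) < 1}.Infinite := by
  have : IsTotallyReal F := ⟨fun w ↦ isReal_iff.mpr <| ComplexEmbedding.isReal_iff.mpr <|
    RingHom.ext fun x ↦ Complex.conj_eq_iff_im.mpr (htotallyReal w.embedding x)⟩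
  have := nontrivial_of_isTotallyReal hF
  obtain ⟨u, hu⟩ := Units.dirichletUnitTheorem.exists_unit F (mk (Complex.ofRealHom.comp ι))
  have hu_lt : ∀ w, w ≠ mk (Complex.ofRealHom.comp ι) → w (u : F) < 1 := fun w hw ↦
    (Real.log_neg_iff (Units.pos_at_place u w)).mp (hu w hw)
  have hι : 1 < ι (u : F) ^ 2 := by
    rw [one_lt_sq_iff_one_lt_abs, ← mk_ofRealHom_comp_apply]
    exact Units.one_lt_of_forall_ne_lt_one hu_lt
  have hσ : ∀ σ : F →+* ℝ, σ ≠ ι → σ (u : F) ^ 2 < 1 := fun σ hne ↦ by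
    rw [sq_lt_one_iff_abs_lt_one, ← mk_ofRealHom_comp_apply]
    exact hu_lt _ (mk_ofRealHom_comp_injective.ne hne)
  obtain ⟨k, hk⟩ := eventually_atTop.mp <|
    (tendsto_pow_atTop_atTop_of_one_lt hι).eventually_gt_atTop N
  have hpow (σ : F →+* ℝ) (n : ℕ) :
      σ (algebraMap (𝓞 F) F (((u ^ 2) ^ n : (𝓞 F)ˣ) : 𝓞 F)) = (σ (u : F) ^ 2) ^ n := by
    simp
  refine Set.infinite_of_injective_forall_mem (f := fun n : ℕ ↦ (u ^ 2) ^ (n + k + 1))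
    (fun m n hmn ↦ ?_) fun n ↦ ⟨?_, fun σ hne ↦ ?_⟩
  · have := congrArg (fun v : (𝓞 F)ˣ ↦ ι (algebraMap (𝓞 F) F (v : 𝓞 F))) hmn
    simp only [hpow] at this
    have := pow_right_injective₀ (zero_lt_one.trans hι) hι.ne' this
    omega
  · rw [hpow]
    exact hk _ (by omega)
  · rw [hpow]
    have hpos : 0 < σ (u : F) ^ 2 :=
      sq_pos_of_ne_zero ((map_ne_zero σ).mpr (Units.coe_ne_zero u))
    exact ⟨pow_pos hpos _, pow_lt_one₀ hpos.le (hσ σ hne) (Nat.succ_ne_zero _)⟩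
end

section
/- Let F be a totally real number field regarded as a subfield of ℝ via a distinguished real embedding, and let u be a unit of O_F with u > 2 (at the identity embedding) and 0 < σ(u) < 1 for every real embedding σ of F other than the identity. Then u² − 4 is not a square in F, and consequently the polynomial p_u(x) = x² − u·x + 1 is irreducible over F. -/
open NumberField Polynomial

/-- A unit of a number field whose images under all complex embeddings have the same absolute
value `r` has `r = 1`. -/
theorem eq_one_of_forall_norm_embedding_eq {F : Type*} [Field F] [NumberField F] (u : (𝓞 F)ˣ)
    (r : ℝ) (hr : 0 ≤ r) (h : ∀ φ : F →+* ℂ, ‖φ (algebraMap (𝓞 F) F (u : 𝓞 F))‖ = r) :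
    r = 1 := by
  have hnorm : |Algebra.norm ℚ (algebraMap (𝓞 F) F (u : 𝓞 F))| = 1 := by simp
  have hprod := congrArg norm
    (Algebra.norm_eq_prod_embeddings ℚ ℂ (algebraMap (𝓞 F) F (u : 𝓞 F)))
  rw [norm_prod, Finset.prod_congr rfl fun φ _ => h φ.toRingHom, Finset.prod_const,
    eq_ratCast, Complex.norm_ratCast, ← Rat.cast_abs, hnorm, Rat.cast_one] at hprod
  refine (pow_eq_one_iff_of_nonneg hr ?_).mp hprod.symm
  rw [Finset.card_univ, AlgHom.card ℚ F ℂ]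
  exact Module.finrank_pos.ne'

/-- If the discriminant `a ^ 2 - 4` is not a square, then `X ^ 2 - a X + 1` is irreducible. -/
theorem irreducible_X_sq_sub_C_mul_X_add_one {K : Type*} [Field K] {a : K}
    (ha : ¬ ∃ y : K, y ^ 2 = a ^ 2 - 4) : Irreducible (X ^ 2 - C a * X + 1 : K[X]) := by
  have hdeg : (X ^ 2 - C a * X + 1 : K[X]).natDegree = 2 := by compute_degree!
  refine irreducible_of_degree_le_three_of_not_isRoot (by simp [hdeg])
    fun x hx => ha ⟨2 * x - a, ?_⟩
  have hx' : x ^ 2 - a * x + 1 = 0 := by simpa [IsRoot] using hx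
  linear_combination 4 * hx'

/-- If `u` is a unit of `𝓞 F` with `ι u > 2` and `0 < σ u < 1` for every real
embedding `σ ≠ ι` of the totally real number field `F`, then `u ^ 2 - 4` is not a square in `F`,
and consequently the polynomial `X ^ 2 - u • X + 1` is irreducible over `F`. -/
theorem special_unit_sq_sub_four_not_square_and_poly_irreducible
    (F : Type*) [Field F] [NumberField F]
    (htotallyReal : ∀ φ : F →+* ℂ, ∀ x : F, (φ x).im = 0)
    (ι : F →+* ℝ)
    (u : (𝓞 F)ˣ)
    (hu : 2 < ι (algebraMap (𝓞 F) F (u : 𝓞 F)))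
    (huσ : ∀ σ : F →+* ℝ, σ ≠ ι →
      0 < σ (algebraMap (𝓞 F) F (u : 𝓞 F)) ∧ σ (algebraMap (𝓞 F) F (u : 𝓞 F)) < 1) :
    (¬ ∃ y : F, y ^ 2 = (algebraMap (𝓞 F) F (u : 𝓞 F)) ^ 2 - 4) ∧
    Irreducible (X ^ 2 - C (algebraMap (𝓞 F) F (u : 𝓞 F)) * X + 1 : F[X]) := by
  have hsq : ¬ ∃ y : F, y ^ 2 = (algebraMap (𝓞 F) F (u : 𝓞 F)) ^ 2 - 4 := by
    rintro ⟨y, hy⟩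
    have hι : ∀ σ : F →+* ℝ, σ = ι := by
      intro σ
      by_contra hσ
      obtain ⟨h0, h1⟩ := huσ σ hσ
      have hσy := congrArg σ hy
      simp only [map_pow, map_sub, map_ofNat] at hσy
      nlinarith [sq_nonneg (σ y)]
    have hone := eq_one_of_forall_norm_embedding_eq u
      (ι (algebraMap (𝓞 F) F (u : 𝓞 F))) (by linarith) fun φ => by
        have hφ : ComplexEmbedding.IsReal φ :=
          ComplexEmbedding.isReal_iff.mpr <| RingHom.ext fun x =>
            Complex.conj_eq_iff_im.mpr (htotallyReal φ x)
        rw [← hφ.coe_embedding_apply, hι hφ.embedding, Complex.norm_real, Real.norm_eq_abs,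
          abs_of_pos (by linarith)]
    linarith
  exact ⟨hsq, irreducible_X_sq_sub_C_mul_X_add_one hsq⟩
end

section
/- Let F be a totally real number field of degree d over ℚ, regarded as a subfield of ℝ via a distinguished real embedding, let u be a unit of O_F with u > 2 and 0 < σ(u) < 1 for every non-identity real embedding σ of F, let s ∈ ℝ be a root of x² − u·x + 1, and let L = F(s). Then L is a number field of degree 2d over ℚ and L has exactly 2 real places; that is, exactly 2 of the ring embeddings L → ℂ have image contained in ℝ. -/
open NumberField

open Polynomial in
/-- A quadratic `X ^ 2 - a X + 1` over a field without roots in that field is the minimal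
polynomial of each of its roots. -/
theorem minpoly_eq_of_sq_sub_mul_add_one {K E : Type*} [Field K] [Field E] [Algebra K E]
    {a : K} (ha : ∀ t : K, t ^ 2 - a * t + 1 ≠ 0) {s : E}
    (hs : s ^ 2 - algebraMap K E a * s + 1 = 0) :
    minpoly K s = X ^ 2 - C a * X + 1 := by
  have hdeg : (X ^ 2 - C a * X + 1 : K[X]).natDegree = 2 := by compute_degree!
  have hmonic : (X ^ 2 - C a * X + 1 : K[X]).Monic := by monicity!
  refine (minpoly.eq_of_irreducible_of_monic ?_ (by simpa using hs) hmonic).symm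
  rw [hmonic.irreducible_iff_roots_eq_zero_of_degree_le_three hdeg.ge (by omega)]
  refine Multiset.eq_zero_of_forall_notMem fun t ht => ha t ?_
  simpa using (mem_roots'.mp ht).2

/-- For `0 < a < 1` the quadratic `t ^ 2 - a t + 1` has no real root. -/
theorem sq_sub_mul_add_one_ne_zero {a : ℝ} (h₀ : 0 < a) (h₁ : a < 1) (t : ℝ) :
    t ^ 2 - a * t + 1 ≠ 0 := by
  intro h
  nlinarith [sq_nonneg (2 * t - a)]

/-- If all complex embeddings of a number field `K` are real, and a unit of `K` exceeds `1` under
a given real embedding, then `K` has another real embedding. -/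
theorem exists_ringHom_ne_of_one_lt_unit {K : Type*} [Field K] [NumberField K]
    (hK : ∀ φ : K →+* ℂ, ∀ x : K, (φ x).im = 0) (ι : K →+* ℝ) (u : (𝓞 K)ˣ)
    (hu : 1 < ι (algebraMap (𝓞 K) K u)) : ∃ σ : K →+* ℝ, σ ≠ ι := by
  by_contra! h
  have hφ (φ : K →ₐ[ℚ] ℂ) (x : K) : φ x = (ι x : ℂ) := by
    have hr : ComplexEmbedding.IsReal (φ : K →+* ℂ) :=
      RingHom.ext fun y => Complex.conj_eq_iff_im.mpr (hK φ y)
    rw [← h hr.embedding, hr.coe_embedding_apply]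
    rfl
  let _ : Unique (K →ₐ[ℚ] ℂ) :=
    { default := (Complex.ofRealHom.comp ι).toRatAlgHom
      uniq := fun φ => AlgHom.ext fun x => hφ φ x }
  have hn := Algebra.norm_eq_prod_embeddings ℚ ℂ (algebraMap (𝓞 K) K u)
  rw [Fintype.prod_unique, hφ, eq_ratCast] at hn
  have hq : ((Algebra.norm ℚ (algebraMap (𝓞 K) K u) : ℚ) : ℝ) = ι (algebraMap (𝓞 K) K u) := by
    exact_mod_cast hn
  have h1 : |(Algebra.norm ℚ (algebraMap (𝓞 K) K u) : ℚ)| = 1 := NumberField.Units.norm K u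
  have h2 : |((Algebra.norm ℚ (algebraMap (𝓞 K) K u) : ℚ) : ℝ)| = 1 := by exact_mod_cast h1
  rw [hq, abs_of_pos (by linarith)] at h2
  linarith

/-- Complex embeddings with real image which restrict to the structure map on `K` correspond to
`K`-algebra homomorphisms to `ℝ`. -/
theorem card_real_embeddings_eq_card_algHom {K L : Type*} [Field K] [Field L] [Algebra K ℝ]
    [Algebra K L]
    (h : ∀ ψ : L →+* ℝ, ψ.comp (algebraMap K L) = algebraMap K ℝ) :
    Nat.card {φ : L →+* ℂ // ∀ x : L, (φ x).im = 0} = Nat.card (L →ₐ[K] ℝ) := by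
  have hreal (φ : {φ : L →+* ℂ // ∀ x : L, (φ x).im = 0}) : ComplexEmbedding.IsReal φ.1 :=
    RingHom.ext fun y => Complex.conj_eq_iff_im.mpr (φ.2 y)
  exact Nat.card_congr
    { toFun := fun φ =>
        { (hreal φ).embedding with commutes' := RingHom.congr_fun (h (hreal φ).embedding) }
      invFun := fun ψ => ⟨Complex.ofRealHom.comp ψ, fun x => Complex.ofReal_im _⟩
      left_inv := fun φ => Subtype.ext <| RingHom.ext fun x => (hreal φ).coe_embedding_apply x
      right_inv := fun ψ => AlgHom.ext fun x => Complex.ofReal_re _ }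

/-- With `F`, `u`, `s`, `L = F(s)` as before and `d = [F : ℚ]`, the field `L`
is a number field of degree `2d` over `ℚ` and has exactly two real places, i.e. exactly two
ring embeddings `L → ℂ` have image contained in `ℝ`. -/
theorem quadratic_extension_degree_and_real_places
    (F : IntermediateField ℚ ℝ) [NumberField F]
    (d : ℕ) (hd : Module.finrank ℚ F = d)
    (htotallyReal : ∀ φ : F →+* ℂ, ∀ x : F, (φ x).im = 0)
    (u : (𝓞 F)ˣ)
    (hu : 2 < ((algebraMap (𝓞 F) F (u : 𝓞 F) : F) : ℝ))
    (huσ : ∀ σ : F →+* ℝ, σ ≠ algebraMap F ℝ →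
      0 < σ (algebraMap (𝓞 F) F (u : 𝓞 F)) ∧ σ (algebraMap (𝓞 F) F (u : 𝓞 F)) < 1)
    (s : ℝ)
    (hs : s ^ 2 - ((algebraMap (𝓞 F) F (u : 𝓞 F) : F) : ℝ) * s + 1 = 0)
    (L : IntermediateField F ℝ) (hL : L = IntermediateField.adjoin F {s}) :
    Module.finrank ℚ L = 2 * d ∧
    Nat.card {φ : L →+* ℂ // ∀ x : L, (φ x).im = 0} = 2 := by
  subst hL
  set a : F := algebraMap (𝓞 F) F (u : 𝓞 F)
  obtain ⟨τ, hτ⟩ := exists_ringHom_ne_of_one_lt_unit htotallyReal (algebraMap F ℝ) u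
    (lt_trans one_lt_two hu)
  have hroot (t : F) : t ^ 2 - a * t + 1 ≠ 0 := fun h =>
    sq_sub_mul_add_one_ne_zero (huσ τ hτ).1 (huσ τ hτ).2 (τ t) (by simpa using congrArg τ h)
  have hmin := minpoly_eq_of_sq_sub_mul_add_one hroot hs
  have hdeg : (minpoly F s).natDegree = 2 := by rw [hmin]; compute_degree!
  have hint : IsIntegral F s := by
    by_contra h
    simp [minpoly.eq_zero h] at hdeg
  have hrestrict (ψ : IntermediateField.adjoin F {s} →+* ℝ) :
      ψ.comp (algebraMap F (IntermediateField.adjoin F {s})) = algebraMap F ℝ := by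
    by_contra hne
    have hgen : (IntermediateField.AdjoinSimple.gen F s) ^ 2
        - algebraMap F (IntermediateField.adjoin F {s}) a * IntermediateField.AdjoinSimple.gen F s
        + 1 = 0 := Subtype.ext hs
    exact sq_sub_mul_add_one_ne_zero (huσ _ hne).1 (huσ _ hne).2
      (ψ (IntermediateField.AdjoinSimple.gen F s)) (by simpa using congrArg ψ hgen)
  have hsplits : ((minpoly F s).map (algebraMap F ℝ)).Splits := by
    have hfactor : (minpoly F s).map (algebraMap F ℝ)
        = (Polynomial.X - Polynomial.C s) * (Polynomial.X - Polynomial.C ((a : ℝ) - s)) := by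
      have hc : Polynomial.C (s ^ 2 - (a : ℝ) * s + 1) = 0 := by rw [hs, Polynomial.C_0]
      have ha : algebraMap F ℝ a = (a : ℝ) := rfl
      simp only [map_add, map_sub, map_mul, map_pow, map_one] at hc
      rw [hmin]
      simp only [Polynomial.map_add, Polynomial.map_sub, Polynomial.map_mul, Polynomial.map_pow,
        Polynomial.map_X, Polynomial.map_C, Polynomial.map_one, map_sub, ha]
      linear_combination hc
    rw [hfactor]
    exact (Polynomial.Splits.X_sub_C _).mul (Polynomial.Splits.X_sub_C _)
  constructor
  · rw [← Module.finrank_mul_finrank ℚ F, hd, IntermediateField.adjoin.finrank hint, hdeg, mul_comm]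
  · rw [card_real_embeddings_eq_card_algHom hrestrict,
      IntermediateField.card_algHom_adjoin_integral F hint
        (minpoly.irreducible hint).separable hsplits, hdeg]
end

section
/- Let F be a totally real number field of degree d over ℚ, regarded as a subfield of ℝ via a distinguished real embedding, let u be a unit of O_F with u > 2 and 0 < σ(u) < 1 for every non-identity real embedding σ of F, let s ∈ ℝ be a root of x² − u·x + 1, and let L = F(s). Then the rank of the unit group O_L^× of the ring of integers of L (the free rank given by Dirichlet's unit theorem, namely r₁ + r₂ − 1) equals d, which is one larger than the rank of O_F^×. -/
open NumberField

namespace NumberField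

open Module InfinitePlace

/-- A totally real number field having a unit whose image under a real embedding exceeds `1` has
another real embedding. -/
lemma exists_real_embedding_ne {F : Type*} [Field F] [NumberField F] [IsTotallyReal F]
    (ι : F →+* ℝ) (u : (𝓞 F)ˣ) (hu : 1 < ι (u : 𝓞 F)) : ∃ σ : F →+* ℝ, σ ≠ ι := by
  by_contra! h
  have key (w : InfinitePlace F) (x : F) : w x = |ι x| := by
    have hw := IsTotallyReal.isReal w
    rw [← norm_embedding_of_isReal hw, h (embedding_of_isReal hw), Real.norm_eq_abs]
  let w : InfinitePlace F := Classical.arbitrary _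
  have h1 : 1 ≤ w ((u⁻¹ : (𝓞 F)ˣ) : 𝓞 F) :=
    one_le_of_lt_one u⁻¹.ne_zero fun z hz ↦ (hz (InfinitePlace.ext _ _ fun k ↦ by
      rw [key, key])).elim
  rw [key] at h1
  have hmul : ι (u : 𝓞 F) * ι ((u⁻¹ : (𝓞 F)ˣ) : 𝓞 F) = 1 := by
    rw [← map_mul, ← map_mul, Units.mul_inv, map_one, map_one]
  have habs := congrArg abs hmul
  rw [abs_mul, abs_one, abs_of_pos (by linarith : 0 < ι (u : 𝓞 F))] at habs
  nlinarith

lemma isTotallyReal_of_forall_im_eq_zero {F : Type*} [Field F]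
    (h : ∀ φ : F →+* ℂ, ∀ x : F, (φ x).im = 0) : IsTotallyReal F where
  isReal _ := isReal_iff.2 <| RingHom.ext fun x ↦ Complex.conj_eq_iff_im.2 (h _ x)

lemma rank_add_one_eq_card_infinitePlace (K : Type*) [Field K] [NumberField K] :
    Units.rank K + 1 = Fintype.card (InfinitePlace K) :=
  Nat.sub_add_cancel Fintype.card_pos

lemma IsTotallyReal.rank_add_one_eq_finrank (F : Type*) [Field F] [NumberField F]
    [IsTotallyReal F] : Units.rank F + 1 = finrank ℚ F := by
  rw [rank_add_one_eq_card_infinitePlace, card_eq_nrRealPlaces_add_nrComplexPlaces,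
    IsTotallyReal.nrComplexPlaces_eq_zero, add_zero, IsTotallyReal.finrank]

/-- A quadratic extension of a number field `F` with exactly two real places has unit
rank `[F : ℚ]`. -/
lemma rank_eq_finrank_of_nrRealPlaces_eq_two {F L : Type*} [Field F] [NumberField F] [Field L]
    [NumberField L] [Algebra F L] (hFL : finrank F L = 2) (hL : nrRealPlaces L = 2) :
    Units.rank L = finrank ℚ F := by
  have hrank := rank_add_one_eq_card_infinitePlace L
  have hplaces := card_eq_nrRealPlaces_add_nrComplexPlaces L
  have hdeg := card_add_two_mul_card_eq_rank L
  have htower := finrank_mul_finrank ℚ F L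
  rw [hFL] at htower
  have hpos : 0 < finrank ℚ F := finrank_pos
  omega

end NumberField

section RealQuadratic

open Module Polynomial NumberField NumberField.InfinitePlace IntermediateField

/-- Adjoining to `F` a root of `x ^ 2 - a * x + 1` not in `F` gives a quadratic extension. -/
lemma finrank_adjoin_root_eq_two {F E : Type*} [Field F] [Field E] [Algebra F E] {a : F} {s : E}
    (hs : s ^ 2 - algebraMap F E a * s + 1 = 0) (hsF : s ∉ (algebraMap F E).range) :
    finrank F (adjoin F {s}) = 2 := by
  have hdeg : (X ^ 2 - C a * X + 1 : F[X]).natDegree = 2 := by compute_degree!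
  have hmonic : (X ^ 2 - C a * X + 1 : F[X]).Monic := by monicity!
  have heval : aeval s (X ^ 2 - C a * X + 1 : F[X]) = 0 := by simpa using hs
  have hint : IsIntegral F s := ⟨_, hmonic, heval⟩
  rw [adjoin.finrank hint]
  refine le_antisymm ?_ ((minpoly.two_le_natDegree_iff hint).2 hsF)
  exact hdeg ▸ natDegree_le_of_dvd (minpoly.dvd F s heval) hmonic.ne_zero

lemma Complex.im_eq_zero_of_quadratic {a : ℝ} (ha : 2 ≤ a) {z : ℂ}
    (hz : z ^ 2 - a * z + 1 = 0) : z.im = 0 := by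
  have hre := congrArg Complex.re hz
  have him := congrArg Complex.im hz
  simp [pow_two] at hre him
  by_contra h
  have h2 : 2 * z.re = a := mul_right_cancel₀ h (by linarith)
  nlinarith [sq_pos_of_ne_zero h]

variable {F : Type*} [Field F] [Algebra F ℝ] {a : F} {s : ℝ}

/-- If `2 ≤ a`, every complex embedding over `F` of the field generated by a root of
`x ^ 2 - a * x + 1` is real. -/
lemma isReal_algHom_of_quadratic (ha : 2 ≤ algebraMap F ℝ a)
    (hs : s ^ 2 - algebraMap F ℝ a * s + 1 = 0) (f : adjoin F {s} →ₐ[F] ℂ) :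
    ComplexEmbedding.IsReal (f : adjoin F {s} →+* ℂ) := by
  let g : adjoin F {s} →ₐ[F] ℂ :=
    ((Complex.conjAe : ℂ →ₐ[ℝ] ℂ).restrictScalars F).comp f
  suffices g = f from RingHom.ext fun x ↦ DFunLike.congr_fun this x
  refine algHom_ext_of_eq_adjoin _ rfl fun x hx ↦ ?_
  obtain rfl : x = s := hx
  refine Complex.conj_eq_iff_im.2 (Complex.im_eq_zero_of_quadratic ha ?_)
  have hgen : (AdjoinSimple.gen F x) ^ 2 - algebraMap F _ a * AdjoinSimple.gen F x + 1 = 0 :=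
    Subtype.ext hs
  have hroot := congrArg f hgen
  simp only [map_add, map_sub, map_mul, map_pow, map_one, map_zero, AlgHom.commutes,
    IsScalarTower.algebraMap_apply F ℝ ℂ] at hroot
  exact hroot

/-- If `σ a ^ 2 < 4` for all real embeddings `σ` other than the given one, then every real
embedding of the field generated by a root of `x ^ 2 - a * x + 1` is an embedding over `F`. -/
lemma comp_algebraMap_eq_of_isReal
    (hσ : ∀ σ : F →+* ℝ, σ ≠ algebraMap F ℝ → σ a ^ 2 < 4)
    (hs : s ^ 2 - algebraMap F ℝ a * s + 1 = 0) {φ : adjoin F {s} →+* ℂ}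
    (hφ : ComplexEmbedding.IsReal φ) :
    φ.comp (algebraMap F (adjoin F {s})) = algebraMap F ℂ := by
  have hcomp : hφ.embedding.comp (algebraMap F (adjoin F {s})) = algebraMap F ℝ := by
    by_contra h
    have hlt := hσ _ h
    have hgen : (AdjoinSimple.gen F s) ^ 2 - algebraMap F _ a * AdjoinSimple.gen F s + 1 = 0 :=
      Subtype.ext hs
    have hroot := congrArg hφ.embedding hgen
    simp only [map_add, map_sub, map_mul, map_pow, map_one, map_zero] at hroot
    rw [RingHom.comp_apply] at hlt
    nlinarith [sq_nonneg (2 * hφ.embedding (AdjoinSimple.gen F s) -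
      hφ.embedding (algebraMap F _ a))]
  ext x
  rw [IsScalarTower.algebraMap_apply F ℝ ℂ, ← hcomp]
  exact (hφ.coe_embedding_apply _).symm

lemma nrRealPlaces_adjoin_root_eq_finrank [NumberField (adjoin F {s})]
    [FiniteDimensional F (adjoin F {s})] [Algebra.IsSeparable F (adjoin F {s})]
    (ha : 2 ≤ algebraMap F ℝ a)
    (hσ : ∀ σ : F →+* ℝ, σ ≠ algebraMap F ℝ → σ a ^ 2 < 4)
    (hs : s ^ 2 - algebraMap F ℝ a * s + 1 = 0) :
    nrRealPlaces (adjoin F {s}) = finrank F (adjoin F {s}) := by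
  classical
  rw [← card_real_embeddings, ← AlgHom.card F (adjoin F {s}) ℂ]
  exact Fintype.card_congr
    { toFun φ := { (φ : adjoin F {s} →+* ℂ) with
        commutes' := RingHom.congr_fun (comp_algebraMap_eq_of_isReal hσ hs φ.2) }
      invFun f := ⟨f, isReal_algHom_of_quadratic ha hs f⟩
      left_inv _ := rfl
      right_inv _ := rfl }

end RealQuadratic

/-- With `F`, `u`, `s`, `L = F(s)` as before and `d = [F : ℚ]`, the rank of the
unit group `(𝓞 L)ˣ` given by Dirichlet's unit theorem (namely `r₁ + r₂ - 1`) equals `d`, which is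
one larger than the rank of `(𝓞 F)ˣ`. -/
theorem unit_rank_of_quadratic_extension
    (F : IntermediateField ℚ ℝ) [NumberField F]
    (d : ℕ) (hd : Module.finrank ℚ F = d)
    (htotallyReal : ∀ φ : F →+* ℂ, ∀ x : F, (φ x).im = 0)
    (u : (𝓞 F)ˣ)
    (hu : 2 < ((algebraMap (𝓞 F) F (u : 𝓞 F) : F) : ℝ))
    (huσ : ∀ σ : F →+* ℝ, σ ≠ algebraMap F ℝ →
      0 < σ (algebraMap (𝓞 F) F (u : 𝓞 F)) ∧ σ (algebraMap (𝓞 F) F (u : 𝓞 F)) < 1)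
    (s : ℝ)
    (hs : s ^ 2 - ((algebraMap (𝓞 F) F (u : 𝓞 F) : F) : ℝ) * s + 1 = 0)
    (L : IntermediateField F ℝ) (hL : L = IntermediateField.adjoin F {s})
    (hLnf : NumberField L) :
    @NumberField.Units.rank L _ hLnf = d ∧
    @NumberField.Units.rank L _ hLnf = NumberField.Units.rank F + 1 := by
  subst hL hd
  have := isTotallyReal_of_forall_im_eq_zero htotallyReal
  set a : F := algebraMap (𝓞 F) F (u : 𝓞 F)
  have hσ (σ : F →+* ℝ) (h : σ ≠ algebraMap F ℝ) : σ a ^ 2 < 4 := by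
    nlinarith [huσ σ h]
  have hsF : s ∉ (algebraMap F ℝ).range := by
    rintro ⟨t, rfl⟩
    obtain ⟨σ, hne⟩ := exists_real_embedding_ne (algebraMap F ℝ) u (one_lt_two.trans hu)
    have ht : t ^ 2 - a * t + 1 = 0 := Subtype.ext hs
    have hroot := congrArg σ ht
    simp only [map_add, map_sub, map_mul, map_pow, map_one, map_zero] at hroot
    nlinarith [hσ σ hne, sq_nonneg (2 * σ t - σ a)]
  have h2 := finrank_adjoin_root_eq_two (a := a) hs hsF
  have : FiniteDimensional F (IntermediateField.adjoin F {s}) :=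
    Module.finite_of_finrank_eq_succ h2
  have hreal := nrRealPlaces_adjoin_root_eq_finrank (a := a) hu.le hσ hs
  have hrank := rank_eq_finrank_of_nrRealPlaces_eq_two h2 (hreal.trans h2)
  refine ⟨?_, hrank.trans (IsTotallyReal.rank_add_one_eq_finrank F).symm⟩
  convert hrank
end

section
/- Let F be a totally real number field regarded as a subfield of ℝ via a distinguished real embedding, let u be a unit of O_F with u > 2 and 0 < σ(u) < 1 for every non-identity real embedding σ of F, let s ∈ ℝ be a root of x² − u·x + 1, let L = F(s), and let τ be the nontrivial F-algebra automorphism of L. Call a unit v ∈ O_L^× τ-unitary if τ(v) = v⁻¹. Then the τ-unitary units form a subgroup of O_L^× containing s and −s, the element s has infinite order, and there exists a τ-unitary unit s₀ of infinite order such that every τ-unitary unit equals s₀^k or −s₀^k for some integer k (equivalently, the group of τ-unitary units is isomorphic to ℤ × ℤ/2ℤ). -/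
open NumberField

/-- If `f : G →* ℝ` is a homomorphism from a group and `|f|` takes only finitely many values in
`(1, B]`, then all values of `|f|` are powers of a single one. -/
theorem exists_abs_eq_zpow_of_finite {G : Type*} [Group G] (f : G →* ℝ) {B : ℝ} (hB : 1 < B)
    (hfin : {r : ℝ | 1 < r ∧ r ≤ B ∧ ∃ g, |f g| = r}.Finite) :
    ∃ g₀, ∀ g, ∃ k : ℤ, |f g| = |f g₀| ^ k := by
  have hne : ∀ g, f g ≠ 0 := fun g => ((Group.isUnit g).map f).ne_zero
  have hpos : ∀ g, 0 < |f g| := fun g => abs_pos.2 (hne g)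
  let H : AddSubgroup ℝ :=
    { carrier := {x | ∃ g, Real.log |f g| = x}
      zero_mem' := ⟨1, by simp⟩
      add_mem' := by
        rintro _ _ ⟨g, rfl⟩ ⟨h, rfl⟩
        exact ⟨g * h, by rw [map_mul, abs_mul, Real.log_mul (hpos g).ne' (hpos h).ne']⟩
      neg_mem' := by
        rintro _ ⟨g, rfl⟩
        refine ⟨g⁻¹, ?_⟩
        rw [← Real.log_inv, ← abs_inv]
        congr 2
        exact eq_inv_of_mul_eq_one_left (by rw [← map_mul, inv_mul_cancel, map_one]) }
  obtain ⟨a, ha1, haB, ha⟩ : ∃ a, 1 < a ∧ a ≤ B ∧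
      ∀ r ∈ {r : ℝ | 1 < r ∧ r ≤ B ∧ ∃ g, |f g| = r}, a ≤ r := by
    obtain ⟨a, ha, hmin⟩ := (hfin.insert B).exists_minimalFor id _ ⟨B, Set.mem_insert _ _⟩
    have hle : ∀ r ∈ insert B {r : ℝ | 1 < r ∧ r ≤ B ∧ ∃ g, |f g| = r}, a ≤ r := fun r hr =>
      (le_total a r).elim id (hmin hr)
    refine ⟨a, ?_, hle B (Set.mem_insert _ _), fun r hr => hle r (Set.mem_insert_of_mem _ hr)⟩
    rcases ha with rfl | ha
    exacts [hB, ha.1]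
  have hd : Disjoint (H : Set ℝ) (Set.Ioo 0 (Real.log a)) := by
    rw [Set.disjoint_left]
    rintro _ ⟨g, rfl⟩ ⟨h0, h1⟩
    have hg1 : 1 < |f g| := (Real.log_pos_iff (hpos g).le).1 h0
    have hga : |f g| < a := (Real.log_lt_log_iff (hpos g) (one_pos.trans ha1)).1 h1
    exact hga.not_ge (ha _ ⟨hg1, hga.le.trans haB, g, rfl⟩)
  obtain ⟨b, hb⟩ := AddSubgroup.cyclic_of_isolated_zero (Real.log_pos ha1) hd
  obtain ⟨g₀, hg₀⟩ : b ∈ H := by rw [hb]; exact AddSubgroup.mem_closure_singleton_self b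
  refine ⟨g₀, fun g => ?_⟩
  have hg : Real.log |f g| ∈ H := ⟨g, rfl⟩
  rw [hb, AddSubgroup.mem_closure_singleton] at hg
  obtain ⟨k, hk⟩ := hg
  refine ⟨k, Real.log_injOn_pos (hpos g) (zpow_pos (hpos g₀) k) ?_⟩
  rw [Real.log_zpow, hg₀, ← hk, zsmul_eq_mul]

/-- Ring homomorphisms out of a simple extension agree if they agree on the base field and on the
generator. -/
theorem ringHom_ext_of_eq_adjoin_singleton {F E K : Type*} [Field F] [Field E] [Algebra F E]
    [Field K] {L : IntermediateField F E} {s : E} (hL : L = IntermediateField.adjoin F {s})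
    {t : L} (ht : (t : E) = s) {f g : L →+* K}
    (hF : ∀ x : F, f (algebraMap F L x) = g (algebraMap F L x)) (hs : f t = g t) : f = g := by
  subst hL
  ext ⟨x, hx⟩
  induction hx using IntermediateField.adjoin_induction with
  | mem x hx =>
    obtain rfl : x = s := hx
    obtain rfl : t = ⟨x, IntermediateField.mem_adjoin_simple_self F x⟩ := Subtype.ext ht
    exact hs
  | algebraMap x => exact hF x
  | add x y hx hy h₁ h₂ =>
    exact (map_add f ⟨x, hx⟩ ⟨y, hy⟩).trans
      ((congrArg₂ (· + ·) h₁ h₂).trans (map_add g ⟨x, hx⟩ ⟨y, hy⟩).symm)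
  | inv x hx h =>
    exact (map_inv₀ f ⟨x, hx⟩).trans ((congrArg (·⁻¹) h).trans (map_inv₀ g ⟨x, hx⟩).symm)
  | mul x y hx hy h₁ h₂ =>
    exact (map_mul f ⟨x, hx⟩ ⟨y, hy⟩).trans
      ((congrArg₂ (· * ·) h₁ h₂).trans (map_mul g ⟨x, hx⟩ ⟨y, hy⟩).symm)

/-- The roots of `x² - c x + 1` are mutually inverse. -/
theorem eq_or_eq_inv_of_sq_sub_mul_add_one {K : Type*} [Field K] {c x y : K}
    (hx : x ^ 2 - c * x + 1 = 0) (hy : y ^ 2 - c * y + 1 = 0) : y = x ∨ y = x⁻¹ := by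
  have h : (y - x) * (y * x - 1) = 0 := by linear_combination x * hy - y * hx
  rcases mul_eq_zero.1 h with h | h
  exacts [Or.inl (sub_eq_zero.1 h), Or.inr (eq_inv_of_mul_eq_one_left (sub_eq_zero.1 h))]

/-- A complex root of `x² - c x + 1` with `c` real and `|c| < 2` has its inverse as conjugate. -/
theorem conj_eq_inv_of_sq_sub_mul_add_one {c : ℝ} (h0 : -2 < c) (h2 : c < 2) {z : ℂ}
    (hz : z ^ 2 - c * z + 1 = 0) : starRingEnd ℂ z = z⁻¹ := by
  have hz' : starRingEnd ℂ z ^ 2 - c * starRingEnd ℂ z + 1 = 0 := by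
    simpa using congrArg (starRingEnd ℂ) hz
  refine (eq_or_eq_inv_of_sq_sub_mul_add_one hz hz').resolve_left fun h => ?_
  obtain ⟨r, rfl⟩ := Complex.conj_eq_iff_real.1 h
  have hr : r ^ 2 - c * r + 1 = 0 := by exact_mod_cast hz
  nlinarith [sq_nonneg (2 * r - c)]

/-- With `F`, `u`, `s`, `L = F(s)` as before and `τ` the nontrivial `F`-algebra
automorphism of `L`, the `τ`-unitary units (those `v ∈ (𝓞 L)ˣ` with `τ v = v⁻¹`) form a subgroup
of `(𝓞 L)ˣ` containing `s` and `-s`; the unit `s` has infinite order, and there is a `τ`-unitary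
unit `s₀` of infinite order such that every `τ`-unitary unit is `s₀ ^ k` or `-s₀ ^ k` for some
`k : ℤ`. -/
theorem unitary_units_of_quadratic_extension
    (F : IntermediateField ℚ ℝ) [NumberField F]
    (htotallyReal : ∀ φ : F →+* ℂ, ∀ x : F, (φ x).im = 0)
    (u : (𝓞 F)ˣ)
    (hu : 2 < ((algebraMap (𝓞 F) F (u : 𝓞 F) : F) : ℝ))
    (huσ : ∀ σ : F →+* ℝ, σ ≠ algebraMap F ℝ →
      0 < σ (algebraMap (𝓞 F) F (u : 𝓞 F)) ∧ σ (algebraMap (𝓞 F) F (u : 𝓞 F)) < 1)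
    (s : ℝ)
    (hs : s ^ 2 - ((algebraMap (𝓞 F) F (u : 𝓞 F) : F) : ℝ) * s + 1 = 0)
    (L : IntermediateField F ℝ) (hL : L = IntermediateField.adjoin F {s})
    (sL : L) (hsL : (sL : ℝ) = s)
    (τ : L ≃ₐ[F] L) (hτ : τ ≠ AlgEquiv.refl)
    (sU : (𝓞 L)ˣ) (hsU : algebraMap (𝓞 L) L (sU : 𝓞 L) = sL) :
    (∃ U : Subgroup (𝓞 L)ˣ, ∀ v : (𝓞 L)ˣ,
        v ∈ U ↔ τ (algebraMap (𝓞 L) L (v : 𝓞 L)) = (algebraMap (𝓞 L) L (v : 𝓞 L))⁻¹) ∧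
    τ (algebraMap (𝓞 L) L (sU : 𝓞 L)) = (algebraMap (𝓞 L) L (sU : 𝓞 L))⁻¹ ∧
    τ (algebraMap (𝓞 L) L ((-sU : (𝓞 L)ˣ) : 𝓞 L)) =
      (algebraMap (𝓞 L) L ((-sU : (𝓞 L)ˣ) : 𝓞 L))⁻¹ ∧
    ¬ IsOfFinOrder sU ∧
    (∃ s₀ : (𝓞 L)ˣ,
      τ (algebraMap (𝓞 L) L (s₀ : 𝓞 L)) = (algebraMap (𝓞 L) L (s₀ : 𝓞 L))⁻¹ ∧
      ¬ IsOfFinOrder s₀ ∧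
      ∀ v : (𝓞 L)ˣ,
        τ (algebraMap (𝓞 L) L (v : 𝓞 L)) = (algebraMap (𝓞 L) L (v : 𝓞 L))⁻¹ →
        ∃ k : ℤ, v = s₀ ^ k ∨ v = -(s₀ ^ k)) := by
  set c : F := algebraMap (𝓞 F) F (u : 𝓞 F) with hc
  have hsroot : sL ^ 2 - algebraMap F L c * sL + 1 = 0 := by
    apply Subtype.ext
    push_cast
    rw [hsL]
    exact hs
  have hτs : τ sL = sL⁻¹ := by
    have h : τ sL ^ 2 - algebraMap F L c * τ sL + 1 = 0 := by
      simpa using congrArg τ hsroot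
    refine (eq_or_eq_inv_of_sq_sub_mul_add_one hsroot h).resolve_left fun h => hτ ?_
    have := ringHom_ext_of_eq_adjoin_singleton hL hsL (f := (τ : L →+* L)) (g := RingHom.id L)
      (fun x => by simp) h
    exact AlgEquiv.ext fun x => RingHom.congr_fun this x
  have hsabs : |s| ≠ 1 := by
    intro h
    rcases eq_or_eq_neg_of_abs_eq h with rfl | rfl <;> linarith
  let ι : (𝓞 L)ˣ →* ℝ :=
    ((algebraMap L ℝ : L →* ℝ).comp (algebraMap (𝓞 L) L : 𝓞 L →* L)).comp (Units.coeHom (𝓞 L))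
  have hι : ∀ v, ι v = ((algebraMap (𝓞 L) L (v : 𝓞 L) : L) : ℝ) := fun v => rfl
  have hιinj : Function.Injective ι := fun v w h =>
    Units.ext (RingOfIntegers.coe_injective (Subtype.ext h))
  have hιs : ι sU = s := by rw [hι, hsU, hsL]
  have hιfin : ∀ v, IsOfFinOrder v → |ι v| = 1 := fun v hv => by
    obtain ⟨n, hn, h⟩ := isOfFinOrder_iff_pow_eq_one.1 hv
    refine (pow_eq_one_iff_of_nonneg (abs_nonneg _) hn.ne').1 ?_
    rw [← abs_pow, ← map_pow, h, map_one, abs_one]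
  let U : Subgroup (𝓞 L)ˣ :=
    { carrier := {v | τ (algebraMap (𝓞 L) L (v : 𝓞 L)) = (algebraMap (𝓞 L) L (v : 𝓞 L))⁻¹}
      one_mem' := by simp
      mul_mem' := by
        intro v w hv hw
        simp only [Set.mem_ofPred_eq, Units.val_mul, map_mul] at hv hw ⊢
        rw [hv, hw, mul_inv]
      inv_mem' := by
        intro v hv
        have h : algebraMap (𝓞 L) L ((v⁻¹ : (𝓞 L)ˣ) : 𝓞 L) =
            (algebraMap (𝓞 L) L (v : 𝓞 L))⁻¹ :=
          eq_inv_of_mul_eq_one_left (by rw [← map_mul, Units.inv_mul, map_one])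
        simp only [Set.mem_ofPred_eq] at hv ⊢
        rw [h, map_inv₀, hv] }
  have hsmem : sU ∈ U := by
    change τ _ = _
    rw [hsU, hτs]
  have hsinf : ¬ IsOfFinOrder sU := fun h => hsabs (hιs ▸ hιfin sU h)
  have hemb : ∀ v ∈ U, 1 ≤ |ι v| → ∀ ψ : L →+* ℂ,
      ‖ψ (algebraMap (𝓞 L) L (v : 𝓞 L))‖ ≤ |ι v| := by
    intro v hv hv1 ψ
    replace hv : τ (algebraMap (𝓞 L) L (v : 𝓞 L)) = (algebraMap (𝓞 L) L (v : 𝓞 L))⁻¹ := hv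
    have hφ : ComplexEmbedding.IsReal (ψ.comp (algebraMap F L)) :=
      RingHom.ext fun x => Complex.conj_eq_iff_im.2 (htotallyReal _ x)
    let σ : F →+* ℝ := hφ.embedding
    have hσ : ∀ x : F, ψ (algebraMap F L x) = σ x := fun x =>
      (hφ.coe_embedding_apply x).symm
    have hψs : ψ sL ^ 2 - (σ c : ℂ) * ψ sL + 1 = 0 := by
      rw [← hσ]
      simpa using congrArg ψ hsroot
    by_cases h : σ = algebraMap F ℝ
    · let i : L →+* ℂ := Complex.ofRealHom.comp (algebraMap L ℝ)
      have hiF : ∀ x : F, ψ (algebraMap F L x) = i (algebraMap F L x) := fun x => by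
        rw [hσ, h]; rfl
      have his : i sL ^ 2 - (σ c : ℂ) * i sL + 1 = 0 := by
        rw [← hσ, hiF]
        simpa using congrArg i hsroot
      have hiv : ‖i (algebraMap (𝓞 L) L (v : 𝓞 L))‖ = |ι v| := Complex.norm_real _
      rcases eq_or_eq_inv_of_sq_sub_mul_add_one his hψs with h' | h'
      · rw [ringHom_ext_of_eq_adjoin_singleton hL hsL hiF h', hiv]
      · have : ψ = i.comp (τ : L →+* L) :=
          ringHom_ext_of_eq_adjoin_singleton hL hsL (fun x => by simpa using hiF x)
            (by simp [hτs, h'])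
        rw [this, RingHom.comp_apply, RingHom.coe_coe, hv, map_inv₀, norm_inv, hiv]
        exact (inv_le_one_of_one_le₀ hv1).trans hv1
    · obtain ⟨h0, h1⟩ := huσ σ h
      have hconj : (starRingEnd ℂ).comp ψ = ψ.comp (τ : L →+* L) :=
        ringHom_ext_of_eq_adjoin_singleton hL hsL (fun x => by simp [hσ])
          (by simpa [hτs] using
            conj_eq_inv_of_sq_sub_mul_add_one (by linarith) (by linarith) hψs)
      have hnorm := congrArg norm (RingHom.congr_fun hconj (algebraMap (𝓞 L) L (v : 𝓞 L)))
      rw [RingHom.comp_apply, RingHom.comp_apply, RingHom.coe_coe, hv, map_inv₀, norm_inv,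
        Complex.norm_conj] at hnorm
      have hne : ‖ψ (algebraMap (𝓞 L) L (v : 𝓞 L))‖ ≠ 0 :=
        norm_ne_zero_iff.2 ((v.isUnit.map (algebraMap (𝓞 L) L)).map ψ).ne_zero
      have hsq : ‖ψ (algebraMap (𝓞 L) L (v : 𝓞 L))‖ ^ 2 = 1 := by
        rw [sq]
        nth_rw 1 [hnorm]
        exact inv_mul_cancel₀ hne
      exact ((pow_eq_one_iff_of_nonneg (norm_nonneg _) two_ne_zero).1 hsq).trans_le hv1
  have hLfin : FiniteDimensional F L := by
    rw [hL]
    refine IntermediateField.adjoin.finiteDimensional ⟨.X ^ 2 - .C c * .X + 1, ?_, ?_⟩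
    · monicity!
    · simpa using hs
  have : NumberField L := { to_finiteDimensional := Module.Finite.trans F L }
  obtain ⟨⟨s₀, hs₀⟩, hgen⟩ := exists_abs_eq_zpow_of_finite (ι.comp U.subtype) one_lt_two (by
    refine ((Embeddings.finite_of_norm_le L ℂ 2).image fun x : L => |(x : ℝ)|).subset ?_
    rintro r ⟨h1, h2, ⟨v, hv⟩, rfl⟩
    exact ⟨algebraMap (𝓞 L) L (v : 𝓞 L), ⟨RingOfIntegers.isIntegral_coe _,
      fun ψ => (hemb v hv h1.le ψ).trans h2⟩, rfl⟩)
  refine ⟨⟨U, fun v => Iff.rfl⟩, hsmem, ?_, hsinf, s₀, hs₀, fun h => ?_, fun v hv => ?_⟩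
  · simp [hsU, hτs, inv_neg]
  · obtain ⟨k, hk⟩ := hgen ⟨sU, hsmem⟩
    apply hsabs
    simpa [hιs, hιfin s₀ h] using hk
  · obtain ⟨k, hk⟩ := hgen ⟨v, hv⟩
    have hk' : |ι v| = |ι (s₀ ^ k)| := by
      have : ι (s₀ ^ k) = ι s₀ ^ k := map_zpow' ι (fun w =>
        eq_inv_of_mul_eq_one_left (by rw [← map_mul, inv_mul_cancel, map_one])) s₀ k
      rw [this, abs_zpow]
      exact hk
    refine ⟨k, (abs_eq_abs.1 hk').imp (fun h => hιinj h) fun h => hιinj ?_⟩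
    rw [h]
    simp [hι]
end

section
/- Let n ≥ 3 and let G ⊂ GL(n+1, ℝ) be the set of (n+1)×(n+1) real matrices g of the following block form with respect to the decomposition ℝ^{n+1} = ℝ ⊕ ℝ ⊕ ℝ^{n−2} ⊕ ℝ: the first row of g is (1, 0, v, w), the second row is (0, u, 0, 0), the middle (n−2) rows form the blocks (0, 0, I_{n−2}, vᵀ), and the last row is (0, 0, 0, 1), where u ranges over all nonzero reals, w over all reals, and v over all row vectors in ℝ^{n−2}. Let x ∈ ℝ^{n+1} be a nonzero vector whose second coordinate x₂ and last coordinate x_{n+1} are both nonzero. Then the orbit of the projective point [x] under G, i.e. the set { [g·x] : g ∈ G } ⊂ ℝP^n, is an open subset of the real projective space ℝP^n. -/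
open Matrix

/-- The matrix with rows `(1,0,v,w)`, `(0,u,0,0)`, `(0,0,I_{n-2},vᵀ)`, `(0,0,0,1)` with respect
to the decomposition `ℝ^{n+1} = ℝ ⊕ ℝ ⊕ ℝ^{n-2} ⊕ ℝ` (only the coordinates of `v` at the middle
indices `2,…,n-1` are used). -/
def P1barMatrix (n : ℕ) (u w : ℝ) (v : Fin (n + 1) → ℝ) :
    Matrix (Fin (n + 1)) (Fin (n + 1)) ℝ :=
  Matrix.of fun i j =>
    if i = 0 then
      (if j = 0 then 1 else if j = 1 then 0 else if j = Fin.last n then w else v j)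
    else if i = 1 then (if j = 1 then u else 0)
    else if i = Fin.last n then (if j = Fin.last n then 1 else 0)
    else (if j = i then 1 else if j = Fin.last n then v i else 0)

theorem P1barMatrix_mulVec_zero {n : ℕ} (hl0 : Fin.last n ≠ 0) (hl1 : Fin.last n ≠ 1)
    (u w : ℝ) (v x : Fin (n + 1) → ℝ) :
    (P1barMatrix n u w v).mulVec x 0 =
      (P1barMatrix n u 0 v).mulVec x 0 + w * x (Fin.last n) := by
  have h : ∀ j, P1barMatrix n u w v 0 j * x j =
      P1barMatrix n u 0 v 0 j * x j + if j = Fin.last n then w * x j else 0 := by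
    intro j
    by_cases hj : j = Fin.last n
    · subst hj
      simp [P1barMatrix, hl0, hl1]
    · simp [P1barMatrix, hj]
  simp only [Matrix.mulVec, dotProduct, h, Finset.sum_add_distrib, Finset.sum_ite_eq',
    Finset.mem_univ, if_true]

theorem P1barMatrix_mulVec_one {n : ℕ} (h1 : (1 : Fin (n + 1)) ≠ 0)
    (u w : ℝ) (v x : Fin (n + 1) → ℝ) :
    (P1barMatrix n u w v).mulVec x 1 = u * x 1 := by
  simp [Matrix.mulVec, dotProduct, P1barMatrix, h1]

theorem P1barMatrix_mulVec_last {n : ℕ} (hl0 : Fin.last n ≠ 0) (hl1 : Fin.last n ≠ 1)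
    (u w : ℝ) (v x : Fin (n + 1) → ℝ) :
    (P1barMatrix n u w v).mulVec x (Fin.last n) = x (Fin.last n) := by
  simp [Matrix.mulVec, dotProduct, P1barMatrix, hl0, hl1]

theorem P1barMatrix_mulVec_middle {n : ℕ} {i : Fin (n + 1)} (hi0 : i ≠ 0) (hi1 : i ≠ 1)
    (hil : i ≠ Fin.last n) (u w : ℝ) (v x : Fin (n + 1) → ℝ) :
    (P1barMatrix n u w v).mulVec x i = x i + v i * x (Fin.last n) := by
  have h : ∀ j, P1barMatrix n u w v i j * x j =
      (if j = i then x j else 0) + if j = Fin.last n then v i * x j else 0 := by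
    intro j
    by_cases hj : j = i
    · subst hj
      simp [P1barMatrix, hi0, hi1, hil]
    · simp [P1barMatrix, hi0, hi1, hil, hj]
  simp only [Matrix.mulVec, dotProduct, h, Finset.sum_add_distrib, Finset.sum_ite_eq',
    Finset.mem_univ, if_true]

/-- A vector lies in the cone over the orbit of `x` exactly when its second and last coordinates do
not vanish. -/
theorem exists_eq_smul_P1barMatrix_mulVec_iff {n : ℕ} (hn : 2 ≤ n) {x : Fin (n + 1) → ℝ}
    (hx1 : x 1 ≠ 0) (hxlast : x (Fin.last n) ≠ 0) (y : Fin (n + 1) → ℝ) :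
    (∃ (u w : ℝ) (v : Fin (n + 1) → ℝ) (c : ℝ), u ≠ 0 ∧ c ≠ 0 ∧
        y = c • (P1barMatrix n u w v).mulVec x) ↔ y 1 ≠ 0 ∧ y (Fin.last n) ≠ 0 := by
  obtain ⟨m, rfl⟩ := Nat.exists_eq_add_of_le' hn
  have h1 : (1 : Fin (m + 2 + 1)) ≠ 0 := by simp
  have hl0 : Fin.last (m + 2) ≠ 0 := by simp [Fin.ext_iff]
  have hl1 : Fin.last (m + 2) ≠ 1 := by simp [Fin.ext_iff]
  constructor
  · rintro ⟨u, w, v, c, hu, hc, rfl⟩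
    simp only [Pi.smul_apply, smul_eq_mul, P1barMatrix_mulVec_one h1,
      P1barMatrix_mulVec_last hl0 hl1]
    exact ⟨mul_ne_zero hc (mul_ne_zero hu hx1), mul_ne_zero hc hxlast⟩
  · rintro ⟨hy1, hyl⟩
    set c := y (Fin.last (m + 2)) / x (Fin.last (m + 2)) with hc_def
    have hc : c ≠ 0 := div_ne_zero hyl hxlast
    set v : Fin (m + 2 + 1) → ℝ := fun i => (y i / c - x i) / x (Fin.last (m + 2)) with hv
    set u := y 1 / (c * x 1) with hu
    refine ⟨u, (y 0 / c - (P1barMatrix (m + 2) u 0 v).mulVec x 0) / x (Fin.last (m + 2)), v, c,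
      div_ne_zero hy1 (mul_ne_zero hc hx1), hc, ?_⟩
    ext i
    rw [Pi.smul_apply, smul_eq_mul]
    by_cases hi0 : i = 0
    · subst hi0
      rw [P1barMatrix_mulVec_zero hl0 hl1]
      field_simp
      ring
    by_cases hi1 : i = 1
    · subst hi1
      rw [P1barMatrix_mulVec_one h1, hu]
      field_simp
    by_cases hil : i = Fin.last (m + 2)
    · subst hil
      rw [P1barMatrix_mulVec_last hl0 hl1, hc_def]
      field_simp
    · rw [P1barMatrix_mulVec_middle hi0 hi1 hil, hv]
      field_simp
      ring

/-- For `n ≥ 3` and a nonzero vector `x ∈ ℝ^{n+1}` whose second and last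
coordinates are nonzero, the orbit of the projective point `[x]` under the group `G` of matrices
`P1barMatrix n u w v` (with `u ≠ 0`) is open in `ℝP^n`.  Equivalently (since `ℝP^n` carries the
quotient topology from `ℝ^{n+1} \ {0}` and the cone below consists of nonzero vectors), the cone
over the orbit, `{c • (g · x) : g ∈ G, c ≠ 0}`, is open in `ℝ^{n+1}`. -/
theorem P1bar_orbit_isOpen
    (n : ℕ) (hn : 3 ≤ n)
    (x : Fin (n + 1) → ℝ) (hx : x ≠ 0) (hx1 : x 1 ≠ 0) (hxlast : x (Fin.last n) ≠ 0) :
    IsOpen {y : Fin (n + 1) → ℝ |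
      ∃ (u w : ℝ) (v : Fin (n + 1) → ℝ) (c : ℝ), u ≠ 0 ∧ c ≠ 0 ∧
        y = c • (P1barMatrix n u w v).mulVec x} := by
  simp only [exists_eq_smul_P1barMatrix_mulVec_iff (by omega : 2 ≤ n) hx1 hxlast]
  exact (isOpen_ne_fun (continuous_apply _) continuous_const).inter
    (isOpen_ne_fun (continuous_apply _) continuous_const)
end
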